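/- Let D, K, N be positive natural numbers, let V, V' be D × N real matrices agreeing in every column except possibly the n-th, and let H, H' be K × N real matrices agreeing in every column except possibly the n-th. Suppose every column of V and V' has Euclidean norm at most 1 and every column of H and H' has Euclidean norm at most 1. Then the Frobenius norm of (1/N)(V Hᵀ − V' H'ᵀ) is at most 2/N. (This is the sensitivity of the statistic B when outliers are not modeled, i.e., R = 0.) -/

import Mathlib

open Matrix

/-- Squared Frobenius norm of a difference of two rank-one matrices. -/
lemma sum_sq_mul_sub_mul_le {ι κ : Type*} [Fintype ι] [Fintype κ] (a c : ι → ℝ) (b d : κ → ℝ) :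
    ∑ i, ∑ k, (a i * b k - c i * d k) ^ 2 ≤
      2 * ((∑ i, a i ^ 2) * ∑ k, b k ^ 2) + 2 * ((∑ i, c i ^ 2) * ∑ k, d k ^ 2) := by
  rw [Finset.sum_mul_sum, Finset.sum_mul_sum]
  simp only [Finset.mul_sum, ← Finset.sum_add_distrib]
  gcongr with i _ k _
  nlinarith [sq_nonneg (a i * b k + c i * d k)]

/-- If two pairs of matrices agree off column `n`, then the products `V * Hᵀ` and `V' * H'ᵀ`
differ only by the contribution of column `n`. -/
lemma mul_transpose_sub_apply_of_eq_off_column {ι κ ν : Type*} [Fintype ν]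
    {V V' : Matrix ι ν ℝ} {H H' : Matrix κ ν ℝ} {n : ν}
    (hV : ∀ j, j ≠ n → ∀ i, V i j = V' i j) (hH : ∀ j, j ≠ n → ∀ k, H k j = H' k j)
    (i : ι) (k : κ) :
    (V * Hᵀ - V' * H'ᵀ) i k = V i n * H k n - V' i n * H' k n := by
  simp only [Matrix.sub_apply, Matrix.mul_apply, Matrix.transpose_apply, ← Finset.sum_sub_distrib]
  refine Fintype.sum_eq_single n fun j hj => ?_
  rw [hV j hj, hH j hj, sub_self]

/-- For neighboring `V, V'` and neighboring `H, H'`, with all columns of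
Euclidean norm at most 1, the Frobenius norm of `(1/N)(V Hᵀ − V' H'ᵀ)` is at most `2/N`
(the sensitivity of `B` when outliers are not modeled, i.e. `R = 0`). -/
theorem sensitivity_B_no_outlier (D K N : ℕ) (hD : 0 < D) (hK : 0 < K) (hN : 0 < N)
    (V V' : Matrix (Fin D) (Fin N) ℝ) (H H' : Matrix (Fin K) (Fin N) ℝ) (n : Fin N)
    (hV : ∀ j : Fin N, j ≠ n → ∀ i : Fin D, V i j = V' i j)
    (hH : ∀ j : Fin N, j ≠ n → ∀ i : Fin K, H i j = H' i j)
    (hVcol : ∀ j : Fin N, Real.sqrt (∑ i, (V i j) ^ 2) ≤ 1)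
    (hV'col : ∀ j : Fin N, Real.sqrt (∑ i, (V' i j) ^ 2) ≤ 1)
    (hHcol : ∀ j : Fin N, Real.sqrt (∑ i, (H i j) ^ 2) ≤ 1)
    (hH'col : ∀ j : Fin N, Real.sqrt (∑ i, (H' i j) ^ 2) ≤ 1) :
    Real.sqrt (∑ i, ∑ k,
        ((((N : ℝ)⁻¹ • (V * Hᵀ - V' * H'ᵀ)) : Matrix (Fin D) (Fin K) ℝ) i k) ^ 2)
      ≤ 2 / N := by
  have hprod {x y : ℝ} (hy₀ : 0 ≤ y) (hx : √x ≤ 1) (hy : √y ≤ 1) : x * y ≤ 1 :=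
    mul_le_one₀ (by simpa using hx) hy₀ (by simpa using hy)
  have hVH := hprod (Finset.sum_nonneg fun k _ => sq_nonneg (H k n)) (hVcol n) (hHcol n)
  have hVH' := hprod (Finset.sum_nonneg fun k _ => sq_nonneg (H' k n))
    (hV'col n) (hH'col n)
  have hdiff := sum_sq_mul_sub_mul_le (V · n) (V' · n) (H · n) (H' · n)
  refine Real.sqrt_le_iff.mpr ⟨by positivity, ?_⟩
  simp only [Matrix.smul_apply, mul_transpose_sub_apply_of_eq_off_column hV hH, smul_eq_mul,
    mul_pow, ← Finset.mul_sum]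
  rw [div_eq_inv_mul, mul_pow]
  gcongr
  linarith
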